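/- For every natural number s ≥ 1, setting S₊ = (2+√2)^s and S₋ = (2−√2)^s, the following linear inequality holds for the joint Shannon entropies of any four jointly distributed discrete random variables X₁, X₂, X₃, X₄ with finite entropies: (2^(s−1) − (√2/4)·S₊ + (√2/4)·S₋)·[H(1) + H(2)] − H(3) + (1 − 3·2^(s−1) + (√2/2)·S₊ − (√2/2)·S₋)·H(12) + ((1/4)·S₊ + (1/4)·S₋)·[H(13) + H(23)] + (((√2−1)/4)·S₊ − ((√2+1)/4)·S₋)·[H(14) + H(24)] + (1 − 2^(s−1))·H(34) + (2^(s−1) − (1/2)·S₊ − (1/2)·S₋)·H(123) − (1 − 2^(s−1) + ((√2−1)/2)·S₊ − ((√2+1)/2)·S₋)·H(124) ≥ 0. -/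

import Mathlib

open MeasureTheory

/-- The Shannon entropy of a random variable `X` taking values in a finite set,
computed from the distribution of `X` under the measure `μ`. -/
noncomputable def shannonEntropy {Ω : Type*} [MeasurableSpace Ω] (μ : Measure Ω)
    {β : Type*} [Fintype β] (X : Ω → β) : ℝ :=
  ∑ b : β, Real.negMulLog ((μ (X ⁻¹' {b})).toReal)

section Submodular

variable {L : Type*} [SemilatticeInf L] (h : L → ℝ)

/-- The mutual information `I(x;y)` of an entropy-like function `h`, where `⊓` is joining of
random variables. -/
def mutualInfo (x y : L) : ℝ := h x + h y - h (x ⊓ y)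

/-- The conditional mutual information `I(x;y|z)` of an entropy-like function `h`. -/
def condMutualInfo (x y z : L) : ℝ := h (x ⊓ z) + h (y ⊓ z) - h z - h (x ⊓ y ⊓ z)

/-- The Ingleton expression `I(a;b|c) + I(a;b|d) + I(c;d) - I(a;b)`. -/
def ingleton (a b c d : L) : ℝ :=
  condMutualInfo h a b c + condMutualInfo h a b d + mutualInfo h c d - mutualInfo h a b

/-- The sum `I(a;c|b) + I(b;c|a)`. -/
def crossInfo (a b c : L) : ℝ := condMutualInfo h a c b + condMutualInfo h b c a

/-- The expression
`P * ingleton + I(a;b|c) + e * (I(a;c|b) + I(b;c|a)) + f * (I(a;d|b) + I(b;d|a))`. -/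
def weightedIngleton (P e f : ℝ) (a b c d : L) : ℝ :=
  P * ingleton h a b c d + condMutualInfo h a b c + e * crossInfo h a b c + f * crossInfo h a b d

/-- `r` behaves like a copy of `c` over `a ⊓ b`, conditionally independent of `c ⊓ d`. -/
structure IsCopyOver (a b c d r : L) : Prop where
  eq : h r = h c
  eq_left : h (a ⊓ r) = h (a ⊓ c)
  eq_right : h (b ⊓ r) = h (b ⊓ c)
  eq_both : h (a ⊓ b ⊓ r) = h (a ⊓ b ⊓ c)
  indep_c : h (a ⊓ b ⊓ c ⊓ r) = h (a ⊓ b ⊓ c) + h (a ⊓ b ⊓ c) - h (a ⊓ b)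
  indep_d : h (a ⊓ b ⊓ d ⊓ r) = h (a ⊓ b ⊓ d) + h (a ⊓ b ⊓ c) - h (a ⊓ b)
  indep : h (a ⊓ b ⊓ c ⊓ d ⊓ r) = h (a ⊓ b ⊓ c ⊓ d) + h (a ⊓ b ⊓ c) - h (a ⊓ b)

variable {h} {a b c d r : L}

lemma ingleton_le_of_isCopyOver (hsub : ∀ x y z, 0 ≤ condMutualInfo h x y z)
    (hr : IsCopyOver h a b c d r) :
    ingleton h (a ⊓ r) (b ⊓ r) (c ⊓ r) d ≤ ingleton h a b c d + crossInfo h a b c := by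
  obtain ⟨h1, h2, h3, h4, h5, h6, h7⟩ := hr
  have i1 := hsub d r a
  have i2 := hsub c r b
  have i3 := hsub a r (b ⊓ c ⊓ d)
  have i4 := hsub b r (c ⊓ d)
  have i5 := hsub c r a
  have i6 := hsub d r b
  simp only [ingleton, crossInfo, condMutualInfo, mutualInfo, inf_comm, inf_left_comm, inf_idem] at *
  linarith

lemma ingleton_swap_le_of_isCopyOver (hsub : ∀ x y z, 0 ≤ condMutualInfo h x y z)
    (hr : IsCopyOver h a b c d r) :
    ingleton h (a ⊓ r) (b ⊓ r) (d ⊓ r) c ≤ ingleton h a b c d + crossInfo h a b c := by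
  obtain ⟨h1, h2, h3, h4, h5, h6, h7⟩ := hr
  have i1 := hsub d r a
  have i2 := hsub c r b
  have i3 := hsub a r (b ⊓ c ⊓ d)
  have i4 := hsub b r (c ⊓ d)
  have i5 := hsub c r a
  have i6 := hsub d r b
  simp only [ingleton, crossInfo, condMutualInfo, mutualInfo, inf_comm, inf_left_comm, inf_idem] at *
  linarith

lemma condMutualInfo_add_le_of_isCopyOver (hsub : ∀ x y z, 0 ≤ condMutualInfo h x y z)
    (hr : IsCopyOver h a b c d r) :
    condMutualInfo h (a ⊓ r) (b ⊓ r) (c ⊓ r) + condMutualInfo h (a ⊓ r) (b ⊓ r) (d ⊓ r) ≤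
      ingleton h a b c d + condMutualInfo h a b c + crossInfo h a b c := by
  obtain ⟨h1, h2, h3, h4, h5, h6, h7⟩ := hr
  have i1 := hsub d r a
  have i2 := hsub c r b
  have i3 := hsub a r (b ⊓ c ⊓ d)
  have i4 := hsub b r (c ⊓ d)
  have i5 := hsub c r a
  have i6 := hsub d r b
  have i7 := hsub c d r
  simp only [ingleton, crossInfo, condMutualInfo, mutualInfo, inf_comm, inf_left_comm, inf_idem] at *
  linarith

lemma crossInfo_add_le_of_isCopyOver (hsub : ∀ x y z, 0 ≤ condMutualInfo h x y z)
    (hr : IsCopyOver h a b c d r) :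
    crossInfo h (a ⊓ r) (b ⊓ r) (c ⊓ r) + crossInfo h (a ⊓ r) (b ⊓ r) d ≤
      crossInfo h a b c + crossInfo h a b d := by
  obtain ⟨h1, h2, h3, h4, h5, h6, h7⟩ := hr
  have i1 := hsub c r b
  have i2 := hsub c r a
  have i3 := hsub d r b
  have i4 := hsub d r a
  simp only [crossInfo, condMutualInfo, inf_comm, inf_left_comm, inf_idem] at *
  linarith

lemma crossInfo_inf_right (h : L → ℝ) (a b c r : L) :
    crossInfo h (a ⊓ r) (b ⊓ r) (c ⊓ r) = crossInfo h (a ⊓ r) (b ⊓ r) c := by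
  simp only [crossInfo, condMutualInfo, inf_comm, inf_left_comm, inf_idem]

/-- Doubling step: the inequality for `(P, e, f)`, applied with the copy `r` adjoined and with the
roles of `c` and `d` in both orders, gives the inequality for `(2P+1, 3e+f+2P+1, e+f)`. -/
lemma weightedIngleton_double_nonneg (hsub : ∀ x y z, 0 ≤ condMutualInfo h x y z)
    (hr : IsCopyOver h a b c d r) {P e f : ℝ} (hP : 0 ≤ P) (he : 0 ≤ e) (hf : 0 ≤ f)
    (hcd : 0 ≤ weightedIngleton h P e f (a ⊓ r) (b ⊓ r) (c ⊓ r) d)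
    (hdc : 0 ≤ weightedIngleton h P e f (a ⊓ r) (b ⊓ r) (d ⊓ r) c) :
    0 ≤ weightedIngleton h (2 * P + 1) (3 * e + f + 2 * P + 1) (e + f) a b c d := by
  have i1 := mul_le_mul_of_nonneg_left (ingleton_le_of_isCopyOver hsub hr) hP
  have i2 := mul_le_mul_of_nonneg_left (ingleton_swap_le_of_isCopyOver hsub hr) hP
  have i3 := condMutualInfo_add_le_of_isCopyOver hsub hr
  have i4 := mul_le_mul_of_nonneg_left (crossInfo_add_le_of_isCopyOver hsub hr)
    (add_nonneg he hf)
  have i5 : 0 ≤ e * crossInfo h a b c := mul_nonneg he (add_nonneg (hsub _ _ _) (hsub _ _ _))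
  unfold weightedIngleton at *
  rw [crossInfo_inf_right] at hcd hdc i4
  linarith

end Submodular

section SetoidEntropy

lemma setoid_comap_inf {T T' : Type*} (f : T' → T) (s t : Setoid T) :
    s.comap f ⊓ t.comap f = (s ⊓ t).comap f := rfl

open scoped Classical in
/-- The mass of the class of `x` under the weights `p`. -/
noncomputable def classMass {T : Type*} [Fintype T] (p : T → ℝ) (s : Setoid T) (x : T) : ℝ :=
  ∑ y, if s x y then p y else 0

/-- The entropy of the partition into classes of `s` under the weights `p`. -/
noncomputable def setoidEntropy {T : Type*} [Fintype T] (p : T → ℝ) (s : Setoid T) : ℝ :=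
  -∑ x, p x * Real.log (classMass p s x)

variable {T T' : Type*} [Fintype T] [Fintype T'] {p : T → ℝ} {p' : T' → ℝ}

lemma le_classMass (hp : ∀ x, 0 ≤ p x) (s : Setoid T) (x : T) : p x ≤ classMass p s x := by
  classical
  have := Finset.single_le_sum (f := fun y => if s x y then p y else 0)
    (fun y _ => by split_ifs <;> simp [hp]) (Finset.mem_univ x)
  simpa [classMass, Setoid.refl'] using this

lemma classMass_nonneg (hp : ∀ x, 0 ≤ p x) (s : Setoid T) (x : T) : 0 ≤ classMass p s x :=
  (hp x).trans (le_classMass hp s x)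

lemma classMass_pos (hp : ∀ x, 0 ≤ p x) (s : Setoid T) {x : T} (hx : p x ≠ 0) :
    0 < classMass p s x :=
  ((hp x).lt_of_ne' hx).trans_le (le_classMass hp s x)

lemma classMass_congr {s : Setoid T} {x y : T} (hxy : s x y) :
    classMass p s x = classMass p s y := by
  classical
  refine Finset.sum_congr rfl fun z _ => ?_
  have : s x z ↔ s y z := ⟨fun hz => s.trans' (s.symm' hxy) hz, fun hz => s.trans' hxy hz⟩
  simp [this]

lemma setoidEntropy_congr {s t : Setoid T} (hst : ∀ x y, p x ≠ 0 → p y ≠ 0 → (s x y ↔ t x y)) :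
    setoidEntropy p s = setoidEntropy p t := by
  classical
  unfold setoidEntropy
  congr 1
  refine Finset.sum_congr rfl fun x _ => ?_
  by_cases hx : p x = 0
  · simp [hx]
  congr 2
  refine Finset.sum_congr rfl fun y _ => ?_
  by_cases hy : p y = 0
  · simp [hy]
  simp [hst x y hx hy]

open scoped Classical in
/-- Summing against the weights `p'` a function which factors through `f`, when `p` is the image
of `p'` under `f`. -/
lemma sum_mul_comp_of_map {f : T' → T} (hf : ∀ x, (∑ y, if f y = x then p' y else 0) = p x)
    (g : T → ℝ) : ∑ y, p' y * g (f y) = ∑ x, p x * g x := by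
  simp_rw [← hf, Finset.sum_mul]
  rw [Finset.sum_comm]
  refine Finset.sum_congr rfl fun y _ => ?_
  simp [ite_mul]

open scoped Classical in
lemma setoidEntropy_comap {f : T' → T} (hf : ∀ x, (∑ y, if f y = x then p' y else 0) = p x)
    (s : Setoid T) : setoidEntropy p' (s.comap f) = setoidEntropy p s := by
  have hmass : ∀ y, classMass p' (s.comap f) y = classMass p s (f y) := by
    intro y
    have := sum_mul_comp_of_map hf (fun x => if s (f y) x then 1 else 0)
    simpa [classMass, Setoid.comap_rel] using this
  unfold setoidEntropy
  simp_rw [hmass]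
  rw [sum_mul_comp_of_map hf fun x => Real.log (classMass p s x)]

open scoped Classical in
lemma weightedIngleton_comap {f : T' → T} (hf : ∀ x, (∑ y, if f y = x then p' y else 0) = p x)
    (P e g : ℝ) (a b c d : Setoid T) :
    weightedIngleton (setoidEntropy p') P e g (a.comap f) (b.comap f) (c.comap f) (d.comap f) =
      weightedIngleton (setoidEntropy p) P e g a b c d := by
  simp only [weightedIngleton, ingleton, crossInfo, condMutualInfo, mutualInfo, setoid_comap_inf,
    setoidEntropy_comap hf]

/-- On a set contained in one class of `s`, the weights relative to that class sum to at most one. -/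
lemma sum_div_classMass_le_one (hp : ∀ x, 0 ≤ p x) (s : Setoid T) (A : T → Prop)
    [DecidablePred A]
    (hA : ∀ x y, A x → A y → s x y) :
    (∑ x, if A x then p x / classMass p s x else 0) ≤ 1 := by
  classical
  by_cases hne : ∃ x₀, A x₀
  · obtain ⟨x₀, hx₀⟩ := hne
    calc (∑ x, if A x then p x / classMass p s x else 0)
        ≤ ∑ x, (if s x₀ x then p x else 0) / classMass p s x₀ := by
          refine Finset.sum_le_sum fun x _ => ?_
          by_cases hx : A x
          · have hxx := hA x₀ x hx₀ hx
            simp [hx, hxx, classMass_congr (p := p) hxx]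
          · rw [if_neg hx]
            exact div_nonneg (by split_ifs <;> simp [hp]) (classMass_nonneg hp s x₀)
      _ = classMass p s x₀ / classMass p s x₀ := by rw [← Finset.sum_div]; rfl
      _ ≤ 1 := div_self_le_one _
  · push Not at hne
    simp [hne]

/-- Strong subadditivity of the entropy of partitions. -/
lemma condMutualInfo_setoidEntropy_nonneg (hp : ∀ x, 0 ≤ p x) (s t u : Setoid T) :
    0 ≤ condMutualInfo (setoidEntropy p) s t u := by
  classical
  set w : Setoid T := s ⊓ t ⊓ u with hw
  set q : T → ℝ := fun x => classMass p (s ⊓ u) x * classMass p (t ⊓ u) x /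
    (classMass p w x * classMass p u x) with hq
  have hlog : ∀ x, p x * (1 - q x) ≤ p x * (Real.log (classMass p w x) +
      Real.log (classMass p u x) - Real.log (classMass p (s ⊓ u) x) -
      Real.log (classMass p (t ⊓ u) x)) := by
    intro x
    by_cases hx : p x = 0
    · simp [hx]
    have h1 := classMass_pos hp w hx
    have h2 := classMass_pos hp u hx
    have h3 := classMass_pos hp (s ⊓ u) hx
    have h4 := classMass_pos hp (t ⊓ u) hx
    refine mul_le_mul_of_nonneg_left ?_ (hp x)
    have := Real.log_le_sub_one_of_pos (x := q x) (by positivity)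
    rw [hq, Real.log_div (by positivity) (by positivity), Real.log_mul h3.ne' h4.ne',
      Real.log_mul h1.ne' h2.ne'] at this
    simp only [hq]
    linarith
  have hsum : ∑ x, p x * q x ≤ ∑ x, p x := by
    calc ∑ x, p x * q x
        = ∑ x, ∑ y, ∑ z, (if (s ⊓ u) x y ∧ (t ⊓ u) x z then
            p x / classMass p w x else 0) * (p y * p z / classMass p u y) := by
          refine Finset.sum_congr rfl fun x _ => ?_
          have : p x * q x = (∑ y, if (s ⊓ u) x y then p y else 0) *
              (∑ z, if (t ⊓ u) x z then p z else 0) * (p x / (classMass p w x * classMass p u x)) := by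
            simp only [hq, classMass]; ring
          rw [this, Finset.sum_mul_sum, Finset.sum_mul]
          refine Finset.sum_congr rfl fun y _ => ?_
          rw [Finset.sum_mul]
          refine Finset.sum_congr rfl fun z _ => ?_
          by_cases hy : (s ⊓ u) x y
          · by_cases hz : (t ⊓ u) x z
            · have : u x y := hy.2
              rw [if_pos hy, if_pos hz, if_pos ⟨hy, hz⟩, classMass_congr (p := p) this]
              ring
            · simp [hz]
          · simp [hy]
      _ = ∑ y, ∑ z, (∑ x, if (s ⊓ u) x y ∧ (t ⊓ u) x z then p x / classMass p w x else 0) *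
            (p y * p z / classMass p u y) := by
          rw [Finset.sum_comm]
          refine Finset.sum_congr rfl fun y _ => ?_
          rw [Finset.sum_comm]
          simp_rw [Finset.sum_mul]
      _ ≤ ∑ y, ∑ z, (if u y z then 1 else 0) * (p y * p z / classMass p u y) := by
          refine Finset.sum_le_sum fun y _ => Finset.sum_le_sum fun z _ => ?_
          refine mul_le_mul_of_nonneg_right ?_
            (div_nonneg (mul_nonneg (hp y) (hp z)) (classMass_nonneg hp u y))
          by_cases hyz : u y z
          · rw [if_pos hyz]
            refine sum_div_classMass_le_one hp w _ ?_
            rintro x x' ⟨hx, hx'⟩ ⟨hy, hy'⟩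
            exact ⟨⟨s.trans' hx.1 (s.symm' hy.1), t.trans' hx'.1 (t.symm' hy'.1)⟩,
              u.trans' hx.2 (u.symm' hy.2)⟩
          · rw [if_neg hyz]
            refine (Finset.sum_eq_zero fun x _ => if_neg ?_).le
            rintro ⟨hx, hx'⟩
            exact hyz (u.trans' (u.symm' hx.2) hx'.2)
      _ = ∑ y, p y * (classMass p u y / classMass p u y) := by
          refine Finset.sum_congr rfl fun y _ => ?_
          nth_rewrite 2 [classMass]
          rw [Finset.sum_div, Finset.mul_sum]
          refine Finset.sum_congr rfl fun z _ => ?_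
          split_ifs <;> ring
      _ ≤ ∑ y, p y := Finset.sum_le_sum fun y _ =>
          mul_le_of_le_one_right (hp y) (div_self_le_one _)
  have key := Finset.sum_le_sum fun x (_ : x ∈ Finset.univ) => hlog x
  simp only [mul_sub, mul_add, mul_one, Finset.sum_sub_distrib, Finset.sum_add_distrib] at key
  simp only [condMutualInfo, setoidEntropy, ← hw]
  linarith

open scoped Classical in
/-- The weights on `T × T` of two points of `T` that are conditionally independent given their
common class for `u`. -/
noncomputable def copyWeight (p : T → ℝ) (u : Setoid T) (z : T × T) : ℝ :=
  if u z.1 z.2 then p z.1 * p z.2 / classMass p u z.1 else 0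

lemma copyWeight_nonneg (hp : ∀ x, 0 ≤ p x) (u : Setoid T) (z : T × T) :
    0 ≤ copyWeight p u z := by
  unfold copyWeight
  split_ifs
  · exact div_nonneg (mul_nonneg (hp _) (hp _)) (classMass_nonneg hp u _)
  · exact le_rfl

lemma rel_of_copyWeight_ne_zero {u : Setoid T} {z : T × T} (hz : copyWeight p u z ≠ 0) :
    u z.1 z.2 := by
  by_contra hu
  exact hz (if_neg hu)

lemma copyWeight_swap (u : Setoid T) (x y : T) :
    copyWeight p u (x, y) = copyWeight p u (y, x) := by
  unfold copyWeight
  by_cases hxy : u x y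
  · rw [if_pos hxy, if_pos (u.symm' hxy), classMass_congr (p := p) hxy, mul_comm]
  · rw [if_neg hxy, if_neg fun hyx => hxy (u.symm' hyx)]

lemma sum_copyWeight (hp : ∀ x, 0 ≤ p x) (u : Setoid T) (x : T) :
    ∑ y, copyWeight p u (x, y) = p x := by
  classical
  by_cases hx : p x = 0
  · simp [copyWeight, hx]
  have hpos := classMass_pos hp u hx
  calc ∑ y, copyWeight p u (x, y)
      = p x * classMass p u x / classMass p u x := by
        nth_rewrite 1 [classMass]
        rw [Finset.mul_sum, Finset.sum_div]
        refine Finset.sum_congr rfl fun y _ => ?_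
        simp [copyWeight, ite_div]
    _ = p x := mul_div_cancel_right₀ _ hpos.ne'

open scoped Classical in
lemma map_fst_copyWeight (hp : ∀ x, 0 ≤ p x) (u : Setoid T) (x : T) :
    (∑ z : T × T, if z.1 = x then copyWeight p u z else 0) = p x := by
  rw [Fintype.sum_prod_type, Finset.sum_comm, ← sum_copyWeight hp u x]
  exact Finset.sum_congr rfl fun y _ => by simp

open scoped Classical in
lemma map_snd_copyWeight (hp : ∀ x, 0 ≤ p x) (u : Setoid T) (x : T) :
    (∑ z : T × T, if z.2 = x then copyWeight p u z else 0) = p x := by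
  rw [Fintype.sum_prod_type, ← sum_copyWeight hp u x]
  exact Finset.sum_congr rfl fun y _ => by simp [copyWeight_swap u x y]

lemma setoidEntropy_copyWeight_inf (hp : ∀ x, 0 ≤ p x) {s t u : Setoid T} (hs : s ≤ u)
    (ht : t ≤ u) :
    setoidEntropy (copyWeight p u) (s.comap Prod.fst ⊓ t.comap Prod.snd) =
      setoidEntropy p s + setoidEntropy p t - setoidEntropy p u := by
  classical
  have hmass : ∀ z : T × T, u z.1 z.2 →
      classMass (copyWeight p u) (s.comap Prod.fst ⊓ t.comap Prod.snd) z =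
        classMass p s z.1 * classMass p t z.2 / classMass p u z.1 := by
    rintro ⟨x, y⟩ hxy
    simp only [classMass]
    rw [Fintype.sum_prod_type, Finset.sum_mul_sum, Finset.sum_div]
    refine Finset.sum_congr rfl fun x' _ => ?_
    rw [Finset.sum_div]
    refine Finset.sum_congr rfl fun y' _ => ?_
    have hiff : (s.comap Prod.fst ⊓ t.comap Prod.snd) (x, y) (x', y') ↔ s x x' ∧ t y y' := Iff.rfl
    by_cases hx : s x x'
    · by_cases hy : t y y'
      · have hu : u x' y' := u.trans' (u.symm' (hs hx)) (u.trans' hxy (ht hy))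
        rw [if_pos (hiff.2 ⟨hx, hy⟩), if_pos hx, if_pos hy, copyWeight, if_pos hu]
        exact congrArg _ (classMass_congr (u.symm' (hs hx)))
      · rw [if_neg fun hz => hy (hiff.1 hz).2]; simp [hy]
    · rw [if_neg fun hz => hx (hiff.1 hz).1]; simp [hx]
  have hterm : ∀ z : T × T, copyWeight p u z *
      Real.log (classMass (copyWeight p u) (s.comap Prod.fst ⊓ t.comap Prod.snd) z) =
      copyWeight p u z * Real.log (classMass p s z.1) +
      copyWeight p u z * Real.log (classMass p t z.2) -
      copyWeight p u z * Real.log (classMass p u z.1) := by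
    intro z
    by_cases hz : copyWeight p u z = 0
    · simp [hz]
    have hu := rel_of_copyWeight_ne_zero hz
    have hz' := hz
    rw [copyWeight, if_pos hu] at hz'
    have h1 : p z.1 ≠ 0 := fun h0 => hz' (by simp [h0])
    have h2 : p z.2 ≠ 0 := fun h0 => hz' (by simp [h0])
    have p1 := (classMass_pos hp s h1).ne'
    have p2 := (classMass_pos hp t h2).ne'
    have p3 := (classMass_pos hp u h1).ne'
    rw [hmass z hu, Real.log_div (mul_ne_zero p1 p2) p3, Real.log_mul p1 p2]
    ring
  have e1 := sum_mul_comp_of_map (map_fst_copyWeight hp u) fun x => Real.log (classMass p s x)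
  have e2 := sum_mul_comp_of_map (map_snd_copyWeight hp u) fun x => Real.log (classMass p t x)
  have e3 := sum_mul_comp_of_map (map_fst_copyWeight hp u) fun x => Real.log (classMass p u x)
  unfold setoidEntropy
  rw [Finset.sum_congr rfl fun z _ => hterm z, Finset.sum_sub_distrib, Finset.sum_add_distrib,
    e1, e2, e3]
  ring

/-- On `T × T` with the weights `copyWeight p (a ⊓ b)`, the second coordinate provides a copy. -/
lemma isCopyOver_comap_snd (hp : ∀ x, 0 ≤ p x) (a b c d : Setoid T) :
    IsCopyOver (setoidEntropy (copyWeight p (a ⊓ b))) (a.comap Prod.fst) (b.comap Prod.fst)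
      (c.comap Prod.fst) (d.comap Prod.fst) (c.comap Prod.snd) := by
  have hfst := fun s => setoidEntropy_comap (map_fst_copyWeight hp (a ⊓ b)) s
  have hsnd := fun s => setoidEntropy_comap (map_snd_copyWeight hp (a ⊓ b)) s
  have hmixed : ∀ s : Setoid T, a ⊓ b ≤ s →
      setoidEntropy (copyWeight p (a ⊓ b)) (s.comap Prod.fst ⊓ c.comap Prod.snd) =
        setoidEntropy p (s ⊓ c) := by
    intro s hs
    rw [← hsnd]
    refine setoidEntropy_congr fun x y hx hy => and_congr_left fun _ => ?_
    have hx' : s x.1 x.2 := hs (rel_of_copyWeight_ne_zero hx)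
    have hy' : s y.1 y.2 := hs (rel_of_copyWeight_ne_zero hy)
    exact ⟨fun hxy => s.trans' (s.symm' hx') (s.trans' hxy hy'),
      fun hxy => s.trans' hx' (s.trans' hxy (s.symm' hy'))⟩
  have hindep : ∀ s : Setoid T, s ≤ a ⊓ b →
      setoidEntropy (copyWeight p (a ⊓ b)) (s.comap Prod.fst ⊓ c.comap Prod.snd) =
        setoidEntropy p s + setoidEntropy p (a ⊓ b ⊓ c) - setoidEntropy p (a ⊓ b) := by
    intro s hs
    rw [← setoidEntropy_copyWeight_inf hp hs inf_le_left]
    refine setoidEntropy_congr fun x y hx hy => and_congr_right fun hxy => ?_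
    have hx' : (a ⊓ b) x.1 x.2 := rel_of_copyWeight_ne_zero hx
    have hy' : (a ⊓ b) y.1 y.2 := rel_of_copyWeight_ne_zero hy
    have hxy' : (a ⊓ b) x.1 y.1 := hs hxy
    exact ⟨fun hc => ⟨(a ⊓ b).trans' ((a ⊓ b).symm' hx') ((a ⊓ b).trans' hxy' hy'), hc⟩,
      fun hc => hc.2⟩
  refine ⟨?_, ?_, ?_, ?_, ?_, ?_, ?_⟩
  · rw [hsnd, hfst]
  · exact (hmixed a inf_le_left).trans (hfst _).symm
  · exact (hmixed b inf_le_right).trans (hfst _).symm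
  · exact (hmixed (a ⊓ b) le_rfl).trans (hfst _).symm
  · have := hindep (a ⊓ b ⊓ c) inf_le_left
    rw [← hfst (a ⊓ b ⊓ c), ← hfst (a ⊓ b)] at this
    exact this
  · have := hindep (a ⊓ b ⊓ d) inf_le_left
    rw [← hfst (a ⊓ b ⊓ d), ← hfst (a ⊓ b ⊓ c), ← hfst (a ⊓ b)] at this
    exact this
  · have := hindep (a ⊓ b ⊓ c ⊓ d) (inf_le_left.trans inf_le_left)
    rw [← hfst (a ⊓ b ⊓ c ⊓ d), ← hfst (a ⊓ b ⊓ c), ← hfst (a ⊓ b)] at this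
    exact this

/-- The nonnegativity of a weighted Ingleton expression for all finite distributions. -/
def HoldsForEntropies.{u} (P e f : ℝ) : Prop :=
  ∀ (T : Type u) [Fintype T] (p : T → ℝ), (∀ x, 0 ≤ p x) → ∀ a b c d : Setoid T,
    0 ≤ weightedIngleton (setoidEntropy p) P e f a b c d

lemma holdsForEntropies_zero.{u} : HoldsForEntropies.{u} 0 0 0 := by
  intro T _ p hp a b c d
  simpa [weightedIngleton] using condMutualInfo_setoidEntropy_nonneg hp a b c

lemma HoldsForEntropies.double.{u} {P e f : ℝ} (hP : 0 ≤ P) (he : 0 ≤ e) (hf : 0 ≤ f)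
    (H : HoldsForEntropies.{u} P e f) :
    HoldsForEntropies.{u} (2 * P + 1) (3 * e + f + 2 * P + 1) (e + f) := by
  intro T _ p hp a b c d
  have hp' := copyWeight_nonneg hp (a ⊓ b)
  have key : 0 ≤ weightedIngleton (setoidEntropy (copyWeight p (a ⊓ b))) (2 * P + 1)
      (3 * e + f + 2 * P + 1) (e + f) (a.comap Prod.fst) (b.comap Prod.fst) (c.comap Prod.fst)
      (d.comap Prod.fst) := weightedIngleton_double_nonneg (condMutualInfo_setoidEntropy_nonneg hp')
    (isCopyOver_comap_snd hp a b c d) hP he hf (H _ _ hp' _ _ _ _) (H _ _ hp' _ _ _ _)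
  rwa [weightedIngleton_comap (map_fst_copyWeight hp (a ⊓ b))] at key

lemma holdsForEntropies_pow.{u} (k : ℕ) :
    HoldsForEntropies.{u} (2 ^ k - 1)
      (((2 + √2) ^ (k + 1) + (2 - √2) ^ (k + 1)) / 4 - 2 ^ k)
      (√2 / 4 * ((2 + √2) ^ (k + 1) - (2 - √2) ^ (k + 1)) -
        ((2 + √2) ^ (k + 1) + (2 - √2) ^ (k + 1)) / 4 - 2 ^ k + 1) := by
  have hsq : √2 * √2 = 2 := Real.mul_self_sqrt (by norm_num)
  suffices h : ∃ P e f : ℝ, 0 ≤ P ∧ 0 ≤ e ∧ 0 ≤ f ∧ HoldsForEntropies.{u} P e f ∧ P = 2 ^ k - 1 ∧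
      e = ((2 + √2) ^ (k + 1) + (2 - √2) ^ (k + 1)) / 4 - 2 ^ k ∧
      f = √2 / 4 * ((2 + √2) ^ (k + 1) - (2 - √2) ^ (k + 1)) -
        ((2 + √2) ^ (k + 1) + (2 - √2) ^ (k + 1)) / 4 - 2 ^ k + 1 by
    obtain ⟨P, e, f, -, -, -, H, rfl, rfl, rfl⟩ := h
    exact H
  induction k with
  | zero =>
    refine ⟨0, 0, 0, le_rfl, le_rfl, le_rfl, holdsForEntropies_zero, by simp, by ring, ?_⟩
    linear_combination (-1 / 2) * hsq
  | succ k ih =>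
    obtain ⟨P, e, f, hP, he, hf, H, rfl, hE, hF⟩ := ih
    refine ⟨_, _, _, by positivity, by positivity, by positivity, H.double hP he hf, by ring, ?_, ?_⟩
    · rw [hE, hF, pow_succ _ (k + 1), pow_succ _ (k + 1)]
      ring
    · rw [hE, hF, pow_succ _ (k + 1), pow_succ _ (k + 1)]
      linear_combination (-((2 + √2) ^ (k + 1) + (2 - √2) ^ (k + 1)) / 4) * hsq

end SetoidEntropy

section Measure

/-- The Shannon entropy of a function of a discrete random variable `W` is the entropy of its
kernel under the distribution of `W`. -/
lemma shannonEntropy_comp_eq {Ω : Type*} [MeasurableSpace Ω] (μ : Measure Ω) [IsFiniteMeasure μ]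
    {T β : Type*} [Fintype T] [Fintype β] {W : Ω → T} (hW : ∀ t, MeasurableSet (W ⁻¹' {t}))
    (g : T → β) :
    shannonEntropy μ (fun ω => g (W ω)) =
      setoidEntropy (fun t => (μ (W ⁻¹' {t})).toReal) (Setoid.ker g) := by
  classical
  set p : T → ℝ := fun t => (μ (W ⁻¹' {t})).toReal with hp
  have hmass : ∀ y, (μ ((fun ω => g (W ω)) ⁻¹' {y})).toReal = ∑ t, if g t = y then p t else 0 := by
    intro y
    have hset : (fun ω => g (W ω)) ⁻¹' {y} =
        ⋃ t ∈ Finset.univ.filter (fun t => g t = y), W ⁻¹' {t} := by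
      ext ω; simp
    rw [hset, measure_biUnion_finset _ fun t _ => hW t,
      ENNReal.toReal_sum fun t _ => measure_ne_top _ _, Finset.sum_filter]
    intro t _ t' _ htt'
    exact Set.disjoint_left.2 fun ω h1 h2 => htt' (h1.symm.trans h2)
  have hclass : ∀ t, classMass p (Setoid.ker g) t = ∑ t', if g t' = g t then p t' else 0 := by
    intro t
    refine Finset.sum_congr rfl fun t' _ => ?_
    simp [Setoid.ker_def, eq_comm]
  unfold shannonEntropy setoidEntropy
  simp_rw [hmass, hclass, Real.negMulLog, neg_mul, Finset.sum_neg_distrib]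
  congr 1
  exact (sum_mul_comp_of_map (f := g) (p' := p) (fun _ => rfl)
    fun y => Real.log (∑ t', if g t' = y then p t' else 0)).symm

lemma setoid_ker_prodMk {T β γ : Type*} (f : T → β) (g : T → γ) :
    Setoid.ker (fun t => (f t, g t)) = Setoid.ker f ⊓ Setoid.ker g := by
  ext x y
  exact Prod.ext_iff

end Measure

/-- The infinite family of 4-variable non-Shannon-type information inequalities,
indexed by `s ≥ 1`, with `S₊ = (2+√2)^s` and `S₋ = (2-√2)^s`. -/
theorem infinite_family_inequality (s : ℕ) (hs : 1 ≤ s)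
    {Ω : Type*} [MeasurableSpace Ω] (μ : Measure Ω) [IsProbabilityMeasure μ]
    {α₁ α₂ α₃ α₄ : Type*} [Fintype α₁] [Fintype α₂] [Fintype α₃] [Fintype α₄]
    [MeasurableSpace α₁] [MeasurableSpace α₂] [MeasurableSpace α₃] [MeasurableSpace α₄]
    [DiscreteMeasurableSpace α₁] [DiscreteMeasurableSpace α₂]
    [DiscreteMeasurableSpace α₃] [DiscreteMeasurableSpace α₄]
    (X₁ : Ω → α₁) (X₂ : Ω → α₂) (X₃ : Ω → α₃) (X₄ : Ω → α₄)
    (hX₁ : Measurable X₁) (hX₂ : Measurable X₂) (hX₃ : Measurable X₃) (hX₄ : Measurable X₄)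
    (Sp Sm : ℝ) (hSp : Sp = (2 + Real.sqrt 2) ^ s) (hSm : Sm = (2 - Real.sqrt 2) ^ s) :
    ((2 : ℝ) ^ (s - 1) - Real.sqrt 2 / 4 * Sp + Real.sqrt 2 / 4 * Sm)
        * (shannonEntropy μ X₁ + shannonEntropy μ X₂)
      - shannonEntropy μ X₃
      + (1 - 3 * (2 : ℝ) ^ (s - 1) + Real.sqrt 2 / 2 * Sp - Real.sqrt 2 / 2 * Sm)
        * shannonEntropy μ (fun ω => (X₁ ω, X₂ ω))
      + (1 / 4 * Sp + 1 / 4 * Sm)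
        * (shannonEntropy μ (fun ω => (X₁ ω, X₃ ω)) + shannonEntropy μ (fun ω => (X₂ ω, X₃ ω)))
      + ((Real.sqrt 2 - 1) / 4 * Sp - (Real.sqrt 2 + 1) / 4 * Sm)
        * (shannonEntropy μ (fun ω => (X₁ ω, X₄ ω)) + shannonEntropy μ (fun ω => (X₂ ω, X₄ ω)))
      + (1 - (2 : ℝ) ^ (s - 1)) * shannonEntropy μ (fun ω => (X₃ ω, X₄ ω))
      + ((2 : ℝ) ^ (s - 1) - 1 / 2 * Sp - 1 / 2 * Sm)
        * shannonEntropy μ (fun ω => (X₁ ω, X₂ ω, X₃ ω))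
      - (1 - (2 : ℝ) ^ (s - 1) + (Real.sqrt 2 - 1) / 2 * Sp - (Real.sqrt 2 + 1) / 2 * Sm)
        * shannonEntropy μ (fun ω => (X₁ ω, X₂ ω, X₄ ω)) ≥ 0 := by
  have hk : s = s - 1 + 1 := by omega
  set W : Ω → α₁ × α₂ × α₃ × α₄ := fun ω => (X₁ ω, X₂ ω, X₃ ω, X₄ ω)
  have hW : Measurable W := hX₁.prodMk (hX₂.prodMk (hX₃.prodMk hX₄))
  have hWs : ∀ t, MeasurableSet (W ⁻¹' {t}) := fun t => hW (measurableSet_singleton t)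
  set p : α₁ × α₂ × α₃ × α₄ → ℝ := fun t => (μ (W ⁻¹' {t})).toReal
  set a : Setoid (α₁ × α₂ × α₃ × α₄) := Setoid.ker fun t => t.1
  set b : Setoid (α₁ × α₂ × α₃ × α₄) := Setoid.ker fun t => t.2.1
  set c : Setoid (α₁ × α₂ × α₃ × α₄) := Setoid.ker fun t => t.2.2.1
  set d : Setoid (α₁ × α₂ × α₃ × α₄) := Setoid.ker fun t => t.2.2.2
  have key := holdsForEntropies_pow (s - 1) _ p (fun _ => ENNReal.toReal_nonneg) a b c d
  rw [← hk, ← hSp, ← hSm] at key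
  have h1 : shannonEntropy μ X₁ = setoidEntropy p a :=
    shannonEntropy_comp_eq μ hWs fun t => t.1
  have h2 : shannonEntropy μ X₂ = setoidEntropy p b :=
    shannonEntropy_comp_eq μ hWs fun t => t.2.1
  have h3 : shannonEntropy μ X₃ = setoidEntropy p c :=
    shannonEntropy_comp_eq μ hWs fun t => t.2.2.1
  have h12 : shannonEntropy μ (fun ω => (X₁ ω, X₂ ω)) = setoidEntropy p (a ⊓ b) := by
    simpa only [setoid_ker_prodMk] using shannonEntropy_comp_eq μ hWs fun t => (t.1, t.2.1)
  have h13 : shannonEntropy μ (fun ω => (X₁ ω, X₃ ω)) = setoidEntropy p (a ⊓ c) := by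
    simpa only [setoid_ker_prodMk] using shannonEntropy_comp_eq μ hWs fun t => (t.1, t.2.2.1)
  have h23 : shannonEntropy μ (fun ω => (X₂ ω, X₃ ω)) = setoidEntropy p (b ⊓ c) := by
    simpa only [setoid_ker_prodMk] using shannonEntropy_comp_eq μ hWs fun t => (t.2.1, t.2.2.1)
  have h14 : shannonEntropy μ (fun ω => (X₁ ω, X₄ ω)) = setoidEntropy p (a ⊓ d) := by
    simpa only [setoid_ker_prodMk] using shannonEntropy_comp_eq μ hWs fun t => (t.1, t.2.2.2)
  have h24 : shannonEntropy μ (fun ω => (X₂ ω, X₄ ω)) = setoidEntropy p (b ⊓ d) := by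
    simpa only [setoid_ker_prodMk] using shannonEntropy_comp_eq μ hWs fun t => (t.2.1, t.2.2.2)
  have h34 : shannonEntropy μ (fun ω => (X₃ ω, X₄ ω)) = setoidEntropy p (c ⊓ d) := by
    simpa only [setoid_ker_prodMk] using shannonEntropy_comp_eq μ hWs fun t => (t.2.2.1, t.2.2.2)
  have h123 : shannonEntropy μ (fun ω => (X₁ ω, X₂ ω, X₃ ω)) =
      setoidEntropy p (a ⊓ (b ⊓ c)) := by
    simpa only [setoid_ker_prodMk] using shannonEntropy_comp_eq μ hWs fun t => (t.1, t.2.1, t.2.2.1)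
  have h124 : shannonEntropy μ (fun ω => (X₁ ω, X₂ ω, X₄ ω)) =
      setoidEntropy p (a ⊓ (b ⊓ d)) := by
    simpa only [setoid_ker_prodMk] using shannonEntropy_comp_eq μ hWs fun t => (t.1, t.2.1, t.2.2.2)
  rw [h1, h2, h3, h12, h13, h23, h14, h24, h34, h123, h124]
  clear_value a b c d p
  simp only [weightedIngleton, ingleton, crossInfo, condMutualInfo, mutualInfo, inf_comm,
    inf_left_comm] at key ⊢
  linarith
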